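/- Let (H, t) be a half-ribbon Hopf algebra over a field F, with universal R-matrix R = (t⁻¹ ⊗ t⁻¹)·Δ(t), Drinfeld element u = m∘(S ⊗ id)(τ(R)), and ribbon element v = t⁻². Then the element g := v⁻¹·u = t²·u satisfies g = S(t)·t⁻¹ = S(t⁻¹)·t. -/

import Mathlib

open TensorProduct

section HalfRibbonDefs

variable (F : Type*) [Field F] (H : Type*) [Ring H] [HopfAlgebra F H]

/-- Comultiplication as an algebra homomorphism. -/
noncomputable abbrev Δ : H →ₐ[F] H ⊗[F] H := Bialgebra.comulAlgHom F H

/-- Counit as an algebra homomorphism. -/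
noncomputable abbrev ε : H →ₐ[F] F := Bialgebra.counitAlgHom F H

/-- Antipode. -/
noncomputable abbrev antipodeS : H →ₗ[F] H := HopfAlgebra.antipode (R := F)

/-- The flip `a ⊗ b ↦ b ⊗ a` as an algebra automorphism of `H ⊗ H`. -/
noncomputable abbrev τ : H ⊗[F] H ≃ₐ[F] H ⊗[F] H := Algebra.TensorProduct.comm F H H

/-- The map `m ∘ (S ⊗ id) : H ⊗ H → H`, `a ⊗ b ↦ S(a)·b`, applied after flipping.
`drinfeld R = m∘(S ⊗ id)(τ(R))` is the Drinfeld element. -/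
noncomputable def drinfeld (R : H ⊗[F] H) : H :=
  LinearMap.mul' F H ((TensorProduct.map (antipodeS F H) LinearMap.id) (τ F H R))

/-- `R ∈ H ⊗ H` is a universal R-matrix. -/
def IsUniversalRMatrix (R : H ⊗[F] H) : Prop :=
  IsUnit R ∧
  (∀ x : H, R * Δ F H x = τ F H (Δ F H x) * R) ∧
  (Algebra.TensorProduct.map (Δ F H) (AlgHom.id F H)) R
    = (Algebra.TensorProduct.map (Algebra.TensorProduct.includeLeft (R := F) (S := F)) (AlgHom.id F H)) R
      * (Algebra.TensorProduct.map (Algebra.TensorProduct.includeRight (R := F) (A := H) (B := H)) (AlgHom.id F H)) R ∧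
  (Algebra.TensorProduct.map (AlgHom.id F H) (Δ F H)) R
    = (Algebra.TensorProduct.map (AlgHom.id F H) (Algebra.TensorProduct.includeRight (R := F) (A := H) (B := H))) R
      * (Algebra.TensorProduct.map (AlgHom.id F H) (Algebra.TensorProduct.includeLeft (R := F) (S := F))) R ∧
  (Algebra.TensorProduct.lid F H) ((Algebra.TensorProduct.map (ε F H) (AlgHom.id F H)) R) = 1 ∧
  (Algebra.TensorProduct.rid F F H) ((Algebra.TensorProduct.map (AlgHom.id F H) (ε F H)) R) = 1

/-- `v` is a ribbon element for the quasi-triangular Hopf algebra `(H, R)`. -/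
def IsRibbonElement (R : H ⊗[F] H) (v : H) : Prop :=
  IsUnit v ∧
  (∀ x : H, v * x = x * v) ∧
  v * v = drinfeld F H R * antipodeS F H (drinfeld F H R) ∧
  antipodeS F H v = v ∧
  ε F H v = 1 ∧
  Δ F H v = (v ⊗ₜ[F] v) * Ring.inverse (τ F H R * R)

/-- `(H, t)` is a half-ribbon Hopf algebra:  `R := (t⁻¹ ⊗ t⁻¹)·Δ(t)` is a universal
R-matrix and `v := t⁻²` is a ribbon element for `(H, R)`. -/
def IsHalfRibbonElement (t : Hˣ) : Prop :=
  IsUniversalRMatrix F H ((((t⁻¹ : Hˣ) : H) ⊗ₜ[F] ((t⁻¹ : Hˣ) : H)) * Δ F H (t : H)) ∧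
  IsRibbonElement F H ((((t⁻¹ : Hˣ) : H) ⊗ₜ[F] ((t⁻¹ : Hˣ) : H)) * Δ F H (t : H))
    (((t⁻¹ : Hˣ) : H) * ((t⁻¹ : Hˣ) : H))

end HalfRibbonDefs

/-- `u` of `τ(D)·(a ⊗ a)` is `S(a)·m(S ⊗ id)(D)·a`. -/
lemma drinfeld_flip_mul (F : Type*) [Field F] (H : Type*) [Ring H] [HopfAlgebra F H]
    (D : H ⊗[F] H) (a : H) :
    drinfeld F H (τ F H D * (a ⊗ₜ[F] a)) =
      antipodeS F H a *
        LinearMap.mul' F H ((antipodeS F H).rTensor H D) * a := by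
  unfold drinfeld
  induction D using TensorProduct.induction_on with
  | zero => simp
  | tmul x y => simp [HopfAlgebra.antipode_mul_antidistrib, mul_assoc]
  | add x y hx hy =>
    simp only [map_add, add_mul, mul_add] at hx hy ⊢
    rw [hx, hy]

/-- For a half-ribbon Hopf algebra `(H, t)` with
`R = (t⁻¹ ⊗ t⁻¹)·Δ(t)`, Drinfeld element `u` and ribbon element `v = t⁻²`, the
element `g := v⁻¹·u = t²·u` satisfies `g = S(t)·t⁻¹ = S(t⁻¹)·t`. -/
theorem halfRibbon_grouplike_g_eq
    (F : Type*) [Field F] (H : Type*) [Ring H] [HopfAlgebra F H]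
    (t : Hˣ) (ht : IsHalfRibbonElement F H t) :
    ((t : H) * (t : H)) *
        drinfeld F H ((((t⁻¹ : Hˣ) : H) ⊗ₜ[F] ((t⁻¹ : Hˣ) : H)) * Δ F H (t : H)) =
      antipodeS F H (t : H) * ((t⁻¹ : Hˣ) : H) ∧
    ((t : H) * (t : H)) *
        drinfeld F H ((((t⁻¹ : Hˣ) : H) ⊗ₜ[F] ((t⁻¹ : Hˣ) : H)) * Δ F H (t : H)) =
      antipodeS F H ((t⁻¹ : Hˣ) : H) * (t : H) := by
  obtain ⟨⟨-, hR, -, -, hε, -⟩, -, hc, -, hS, -, -⟩ := ht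
  -- the counit of `t` is one
  have hε2 : Coalgebra.counit (R := F) (t : H) = 1 := by
    have key : ∀ D : H ⊗[F] H, (Algebra.TensorProduct.lid F H)
        ((Algebra.TensorProduct.map (ε F H) (AlgHom.id F H)) D) =
        TensorProduct.lid F H ((Coalgebra.counit (R := F) (A := H)).rTensor H D) := by
      intro D
      induction D using TensorProduct.induction_on with
      | zero => simp
      | tmul x y => simp
      | add x y hx hy => simp only [map_add, hx, hy]
    rw [map_mul, map_mul, key (Δ F H (t : H))] at hε
    have h2 := congrArg (ε F H) hε
    simpa [← Bialgebra.counit_mul] using h2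
  -- `R = τ(Δ(t))·(t⁻¹ ⊗ t⁻¹)`
  have hR' : (((t⁻¹ : Hˣ) : H) ⊗ₜ[F] ((t⁻¹ : Hˣ) : H)) * Δ F H (t : H) =
      τ F H (Δ F H (t : H)) * (((t⁻¹ : Hˣ) : H) ⊗ₜ[F] ((t⁻¹ : Hˣ) : H)) := by
    have hu : IsUnit (Δ F H (t : H)) := t.isUnit.map (Δ F H)
    apply hu.mul_right_cancel
    rw [hR (t : H), mul_assoc]
  have hu : drinfeld F H ((((t⁻¹ : Hˣ) : H) ⊗ₜ[F] ((t⁻¹ : Hˣ) : H)) * Δ F H (t : H)) =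
      antipodeS F H ((t⁻¹ : Hˣ) : H) * ((t⁻¹ : Hˣ) : H) := by
    rw [hR', drinfeld_flip_mul]
    have h := HopfAlgebra.mul_antipode_rTensor_comul_apply (R := F) (t : H)
    rw [hε2, map_one] at h
    have h' : LinearMap.mul' F H ((antipodeS F H).rTensor H (Δ F H (t : H))) = 1 := h
    rw [h', mul_one]
  have hc' : ∀ x : H, (t : H) * t * x = x * (t * t) := by
    intro x
    have h := hc ((t : H) * t * x * (t * t))
    simp only [mul_assoc, Units.inv_mul_cancel_left, Units.mul_inv, Units.mul_inv_cancel_left,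
      mul_one] at h
    simp only [mul_assoc]
    exact h.symm
  have hSS : antipodeS F H (t : H) * antipodeS F H ((t⁻¹ : Hˣ) : H) = 1 := by
    rw [← HopfAlgebra.antipode_mul_antidistrib, Units.inv_mul, HopfAlgebra.antipode_one]
  have hg : antipodeS F H (t : H) * ((t⁻¹ : Hˣ) : H) =
      antipodeS F H ((t⁻¹ : Hˣ) : H) * (t : H) := by
    rw [HopfAlgebra.antipode_mul_antidistrib] at hS
    have h := congrArg (fun x => antipodeS F H (t : H) * x * (t : H)) hS
    simp only [← mul_assoc] at h
    rw [hSS, one_mul] at h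
    rw [h]
    simp [mul_assoc]
  have h2 : ((t : H) * (t : H)) *
        drinfeld F H ((((t⁻¹ : Hˣ) : H) ⊗ₜ[F] ((t⁻¹ : Hˣ) : H)) * Δ F H (t : H)) =
      antipodeS F H ((t⁻¹ : Hˣ) : H) * (t : H) := by
    rw [hu, ← mul_assoc, hc']
    simp [mul_assoc]
  exact ⟨h2.trans hg.symm, h2⟩
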